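/- For every positive integer t one has P₃(12t³ + 6t − 3) = P₄(12t² − 1), and both sides equal 3t²(2t²+1)². -/

import Mathlib

/-- `partCount A n` is the number of partitions of `n` into parts from `A`. -/
def partCount (A : Finset ℕ) (n : ℕ) : ℕ :=
  ((Finset.univ : Finset (Nat.Partition n)).filter (fun p => ∀ i ∈ p.parts, i ∈ A)).card

theorem partCount_insert_add {A : Finset ℕ} {a : ℕ} (ha : 0 < a) (haA : a ∉ A) (n : ℕ) :
    partCount (insert a A) (n + a) = partCount A (n + a) + partCount (insert a A) n := by
  unfold partCount
  rw [← Finset.card_filter_add_card_filter_not (fun p : Nat.Partition (n + a) => a ∉ p.parts)]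
  congr 1
  · congr 1
    ext p
    simp only [Finset.mem_filter, Finset.mem_univ, true_and, Finset.mem_insert]
    constructor
    · rintro ⟨h, hp⟩ i hi
      exact (h i hi).resolve_left fun h' => hp (h' ▸ hi)
    · exact fun h => ⟨fun i hi => Or.inr (h i hi), fun hp => haA (h a hp)⟩
  · symm
    refine Finset.card_bij
      (fun p _ => (⟨a ::ₘ p.parts, ?_, ?_⟩ : Nat.Partition (n + a))) ?_ ?_ ?_
    · intro i hi
      rcases Multiset.mem_cons.1 hi with rfl | hi
      · exact ha
      · exact p.parts_pos hi
    · rw [Multiset.sum_cons, p.parts_sum, add_comm]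
    · intro p hp
      simp only [Finset.mem_filter, Finset.mem_univ, true_and] at hp ⊢
      refine ⟨fun i hi => ?_, by simp⟩
      rcases Multiset.mem_cons.1 hi with rfl | hi
      · simp
      · exact hp i hi
    · intro p _ q _ h
      have h' := congrArg Nat.Partition.parts h
      exact Nat.Partition.ext ((Multiset.cons_inj_right a).1 h')
    · intro q hq
      simp only [Finset.mem_filter, Finset.mem_univ, true_and, not_not] at hq
      obtain ⟨hq, haq⟩ := hq
      obtain ⟨s, hs⟩ := Multiset.exists_cons_of_mem haq
      have hsum := q.parts_sum
      rw [hs, Multiset.sum_cons] at hsum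
      refine ⟨⟨s, fun {i} hi => q.parts_pos (by rw [hs]; exact Multiset.mem_cons_of_mem hi),
        by omega⟩, ?_, ?_⟩
      · simp only [Finset.mem_filter, Finset.mem_univ, true_and]
        exact fun i hi => hq i (by rw [hs]; exact Multiset.mem_cons_of_mem hi)
      · exact Nat.Partition.ext hs.symm

theorem partCount_insert_of_lt {A : Finset ℕ} {a n : ℕ} (h : n < a) :
    partCount (insert a A) n = partCount A n := by
  unfold partCount
  congr 1
  ext p
  simp only [Finset.mem_filter, Finset.mem_univ, true_and, Finset.mem_insert]
  refine forall₂_congr fun i hi => ⟨fun h' => h'.resolve_left ?_, Or.inr⟩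
  rintro rfl
  have := Multiset.le_sum_of_mem hi
  rw [p.parts_sum] at this
  omega

theorem partCount_zero (A : Finset ℕ) : partCount A 0 = 1 := by
  simp [partCount]

theorem partCount_empty_succ (n : ℕ) : partCount ∅ (n + 1) = 0 := by
  unfold partCount
  rw [Finset.card_eq_zero, Finset.filter_eq_empty_iff]
  intro p _ h
  have hp := p.parts_sum
  rw [Multiset.eq_zero_of_forall_notMem fun i hi => Finset.notMem_empty i (h i hi)] at hp
  simp at hp

theorem partCount_one (n : ℕ) : partCount {1} n = 1 := by
  induction n with
  | zero => exact partCount_zero _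
  | succ n ih =>
    have h := partCount_insert_add one_pos (Finset.notMem_empty 1) n
    rw [partCount_empty_succ] at h
    simpa [ih] using h

theorem partCount_two (n : ℕ) : partCount {1, 2} n = n / 2 + 1 := by
  rw [show ({1, 2} : Finset ℕ) = insert 2 {1} by decide]
  induction n using Nat.strong_induction_on with
  | _ n ih =>
    by_cases hn : n < 2
    · rw [partCount_insert_of_lt hn, partCount_one]
      omega
    · obtain ⟨m, rfl⟩ := Nat.exists_eq_add_of_le' (not_lt.1 hn)
      rw [partCount_insert_add two_pos (by decide), partCount_one, ih m (by omega)]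
      omega

theorem partCount_three_add (n : ℕ) :
    partCount {1, 2, 3} (n + 3) = (n + 3) / 2 + 1 + partCount {1, 2, 3} n := by
  rw [show ({1, 2, 3} : Finset ℕ) = insert 3 {1, 2} by decide,
    partCount_insert_add three_pos (by decide), partCount_two]

theorem partCount_three_of_lt {n : ℕ} (h : n < 3) : partCount {1, 2, 3} n = n / 2 + 1 := by
  rw [show ({1, 2, 3} : Finset ℕ) = insert 3 {1, 2} by decide,
    partCount_insert_of_lt h, partCount_two]

theorem partCount_three_add_six (n : ℕ) :
    partCount {1, 2, 3} (n + 6) = (n + 6) / 2 + (n + 3) / 2 + 2 + partCount {1, 2, 3} n := by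
  rw [show n + 6 = n + 3 + 3 by rfl, partCount_three_add, partCount_three_add]
  ring

theorem partCount_three_six_mul_add_one (k : ℕ) :
    partCount {1, 2, 3} (6 * k + 1) = 3 * k ^ 2 + 4 * k + 1 := by
  induction k with
  | zero => exact partCount_three_of_lt (by norm_num)
  | succ k ih =>
    rw [show 6 * (k + 1) + 1 = 6 * k + 1 + 6 by ring, partCount_three_add_six, ih,
      show (6 * k + 1 + 6) / 2 = 3 * k + 3 by omega, show (6 * k + 1 + 3) / 2 = 3 * k + 2 by omega]
    ring

theorem partCount_three_six_mul_add_three (k : ℕ) :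
    partCount {1, 2, 3} (6 * k + 3) = 3 * (k + 1) ^ 2 := by
  induction k with
  | zero => rw [partCount_three_add, partCount_three_of_lt (by norm_num)]; rfl
  | succ k ih =>
    rw [show 6 * (k + 1) + 3 = 6 * k + 3 + 6 by ring, partCount_three_add_six, ih,
      show (6 * k + 3 + 6) / 2 = 3 * k + 4 by omega, show (6 * k + 3 + 3) / 2 = 3 * k + 3 by omega]
    ring

theorem partCount_three_six_mul_add_five (k : ℕ) :
    partCount {1, 2, 3} (6 * k + 5) = 3 * k ^ 2 + 8 * k + 5 := by
  induction k with
  | zero =>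
    rw [show 6 * 0 + 5 = 2 + 3 by rfl, partCount_three_add, partCount_three_of_lt (by norm_num)]
    rfl
  | succ k ih =>
    rw [show 6 * (k + 1) + 5 = 6 * k + 5 + 6 by ring, partCount_three_add_six, ih,
      show (6 * k + 5 + 6) / 2 = 3 * k + 5 by omega, show (6 * k + 5 + 3) / 2 = 3 * k + 4 by omega]
    ring

theorem partCount_four_add (n : ℕ) :
    partCount {1, 2, 3, 4} (n + 4) =
      partCount {1, 2, 3} (n + 4) + partCount {1, 2, 3, 4} n := by
  rw [show ({1, 2, 3, 4} : Finset ℕ) = insert 4 {1, 2, 3} by decide,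
    partCount_insert_add four_pos (by decide)]

theorem partCount_four_of_lt {n : ℕ} (h : n < 4) :
    partCount {1, 2, 3, 4} n = partCount {1, 2, 3} n := by
  rw [show ({1, 2, 3, 4} : Finset ℕ) = insert 4 {1, 2, 3} by decide, partCount_insert_of_lt h]

theorem partCount_four_twelve_mul_add_eleven (j : ℕ) :
    partCount {1, 2, 3, 4} (12 * j + 11) = 3 * (j + 1) * (2 * (j + 1) + 1) ^ 2 := by
  induction j with
  | zero =>
    rw [show 12 * 0 + 11 = 3 + 4 + 4 by rfl, partCount_four_add, partCount_four_add,
      partCount_four_of_lt (by norm_num)]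
    have h₁ := partCount_three_six_mul_add_five 1
    have h₂ := partCount_three_six_mul_add_one 1
    have h₃ := partCount_three_six_mul_add_three 0
    norm_num at h₁ h₂ h₃ ⊢
    omega
  | succ j ih =>
    rw [show 12 * (j + 1) + 11 = 12 * j + 11 + 4 + 4 + 4 by ring, partCount_four_add,
      partCount_four_add, partCount_four_add, ih,
      show 12 * j + 11 + 4 + 4 + 4 = 6 * (2 * j + 3) + 5 by ring,
      show 12 * j + 11 + 4 + 4 = 6 * (2 * j + 3) + 1 by ring,
      show 12 * j + 11 + 4 = 6 * (2 * j + 2) + 3 by ring,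
      partCount_three_six_mul_add_one, partCount_three_six_mul_add_three,
      partCount_three_six_mul_add_five]
    ring

theorem stmt5 (t : ℕ) (ht : 0 < t) :
    partCount {1, 2, 3} (12 * t ^ 3 + 6 * t - 3) = partCount {1, 2, 3, 4} (12 * t ^ 2 - 1) ∧
    partCount {1, 2, 3} (12 * t ^ 3 + 6 * t - 3) = 3 * t ^ 2 * (2 * t ^ 2 + 1) ^ 2 := by
  have h₃ : partCount {1, 2, 3} (12 * t ^ 3 + 6 * t - 3) = 3 * t ^ 2 * (2 * t ^ 2 + 1) ^ 2 := by
    obtain ⟨k, hk⟩ := Nat.exists_eq_add_of_lt (show 0 < t * (2 * t ^ 2 + 1) by positivity)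
    rw [zero_add] at hk
    have hn : 12 * t ^ 3 + 6 * t = 6 * (t * (2 * t ^ 2 + 1)) := by ring
    rw [show 12 * t ^ 3 + 6 * t - 3 = 6 * k + 3 by omega, partCount_three_six_mul_add_three, ← hk]
    ring
  have h₄ : partCount {1, 2, 3, 4} (12 * t ^ 2 - 1) = 3 * t ^ 2 * (2 * t ^ 2 + 1) ^ 2 := by
    obtain ⟨j, hj⟩ := Nat.exists_eq_add_of_lt (show 0 < t ^ 2 by positivity)
    rw [zero_add] at hj
    rw [show 12 * t ^ 2 - 1 = 12 * j + 11 by omega, partCount_four_twelve_mul_add_eleven, ← hj]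
  exact ⟨h₃.trans h₄.symm, h₃⟩
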